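/- Let O = {A_1, …, A_p} be a formal orbit portrait with valence v ≥ 2. Then among all complementary arcs of all the sets A_1, …, A_p there is a unique shortest one: there exist an index i and a complementary arc I of A_i such that the length of I is strictly smaller than the length of every other complementary arc of every A_j (j = 1, …, p). -/

import Mathlib

open MeasureTheory

instance : Fact ((0 : ℝ) < 1) := ⟨zero_lt_one⟩

/-- The doubling map `θ ↦ 2θ (mod 1)` on the circle `ℝ/ℤ`. -/
noncomputable def dbl : AddCircle (1 : ℝ) → AddCircle (1 : ℝ) := fun θ => θ + θ

/-- The embedding `θ ↦ e^{2πiθ}` of `ℝ/ℤ` into `ℂ`. -/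
noncomputable def circleEmbed : AddCircle (1 : ℝ) → ℂ := fun θ => (AddCircle.toCircle θ : ℂ)

/-- A formal orbit portrait `{A_1, …, A_p}` (indices mod `p`): nonempty finite sets of angles,
carried bijectively onto each other by the doubling map preserving cyclic order, with all
angles of the same exact period `r·p` under doubling, and with pairwise disjoint convex hulls
of the corresponding sets of points of the unit circle in `ℂ`. -/
structure FormalOrbitPortrait (p r : ℕ) where
  hp : 0 < p
  hr : 1 ≤ r
  A : ZMod p → Set (AddCircle (1 : ℝ))
  nonempty : ∀ j, (A j).Nonempty
  finite : ∀ j, (A j).Finite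
  bijOn : ∀ j, Set.BijOn dbl (A j) (A (j + 1))
  cyclicOrder : ∀ j, ∀ x ∈ A j, ∀ y ∈ A j, ∀ z ∈ A j,
    sbtw x y z → sbtw (dbl x) (dbl y) (dbl z)
  period : ∀ j, ∀ θ ∈ A j, Function.minimalPeriod dbl θ = r * p
  hullDisjoint : ∀ i j : ZMod p, i ≠ j →
    Disjoint (convexHull ℝ (circleEmbed '' A i)) (convexHull ℝ (circleEmbed '' A j))

/-- A complementary arc of a finite set `A` of angles: a connected component of its
complement in the circle. -/
def IsComplArc (A : Set (AddCircle (1 : ℝ))) (I : Set (AddCircle (1 : ℝ))) : Prop :=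
  ∃ x ∈ Aᶜ, I = connectedComponentIn Aᶜ x

/-- Local abbreviation for the projection `ℝ → ℝ/ℤ`. -/
noncomputable abbrev cmk (x : ℝ) : AddCircle (1 : ℝ) := (x : AddCircle (1 : ℝ))

lemma cmk_eq_iff (x y : ℝ) : cmk x = cmk y ↔ ∃ n : ℤ, x = y + n := by
  unfold cmk
  rw [← sub_eq_zero, ← AddCircle.coe_sub, AddCircle.coe_eq_zero_iff]
  constructor
  · rintro ⟨n, hn⟩
    refine ⟨n, ?_⟩
    simp at hn
    linarith
  · rintro ⟨n, hn⟩
    refine ⟨n, ?_⟩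
    simp
    linarith

lemma cmk_add_int (x : ℝ) (n : ℤ) : cmk (x + n) = cmk x := (cmk_eq_iff _ _).2 ⟨n, rfl⟩

lemma cmk_add_one (x : ℝ) : cmk (x + 1) = cmk x := (cmk_eq_iff _ _).2 ⟨1, by simp⟩

lemma cmk_sub_one (x : ℝ) : cmk (x - 1) = cmk x :=
  (cmk_eq_iff _ _).2 ⟨-1, by push_cast; ring⟩

lemma dbl_cmk (x : ℝ) : dbl (cmk x) = cmk (2 * x) := by
  unfold dbl cmk
  rw [← AddCircle.coe_add, two_mul]

lemma exists_rep_Ioc (a : ℝ) (x : AddCircle (1 : ℝ)) : ∃ s, a < s ∧ s ≤ a + 1 ∧ cmk s = x :=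
  ⟨AddCircle.equivIoc 1 a x, (AddCircle.equivIoc 1 a x).2.1, (AddCircle.equivIoc 1 a x).2.2,
    AddCircle.coe_equivIoc (p := 1)⟩

lemma exists_rep_Ico (a : ℝ) (x : AddCircle (1 : ℝ)) : ∃ s, a ≤ s ∧ s < a + 1 ∧ cmk s = x :=
  ⟨AddCircle.equivIco 1 a x, (AddCircle.equivIco 1 a x).2.1, (AddCircle.equivIco 1 a x).2.2,
    AddCircle.coe_equivIco (p := 1)⟩

lemma sbtw_cmk_iff {a b : ℝ} (hab : a < b) (hb : b < a + 1) (x : AddCircle (1 : ℝ)) :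
    sbtw (cmk a) x (cmk b) ↔ ∃ s, a < s ∧ s < b ∧ cmk s = x := by
  obtain ⟨y, rfl⟩ := QuotientAddGroup.mk_surjective x
  rw [sbtw_iff_not_btw]
  have h1 : toIocMod (zero_lt_one' ℝ) b a = a + 1 := by
    rw [toIocMod_eq_iff]
    exact ⟨⟨hb, by linarith⟩, -1, by simp⟩
  have h2 : btw (cmk b) (QuotientAddGroup.mk y) (cmk a) ↔
      toIcoMod (zero_lt_one' ℝ) b y ≤ toIocMod (zero_lt_one' ℝ) b a :=
    QuotientAddGroup.btw_coe_iff
  rw [h2, h1, not_le]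
  constructor
  · intro h
    obtain ⟨⟨h3, h4⟩, z, hz⟩ := (toIcoMod_eq_iff (zero_lt_one' ℝ)).1
      (rfl : toIcoMod (zero_lt_one' ℝ) b y = _)
    refine ⟨toIcoMod (zero_lt_one' ℝ) b y - 1, by linarith, by linarith, ?_⟩
    rw [cmk_sub_one]
    refine (cmk_eq_iff _ y).2 ⟨-z, ?_⟩
    simp at hz
    push_cast
    linarith
  · rintro ⟨s, h3, h4, h5⟩
    obtain ⟨n, hn⟩ := (cmk_eq_iff _ y).1 h5
    have : toIcoMod (zero_lt_one' ℝ) b y = s + 1 := by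
      rw [toIcoMod_eq_iff]
      refine ⟨⟨by linarith, by linarith⟩, -n-1, ?_⟩
      simp
      linarith
    linarith

/-- `(a, b)` is (a lift of) a complementary arc of `A`. -/
def IsGap (A : Set (AddCircle (1 : ℝ))) (a b : ℝ) : Prop :=
  a < b ∧ b < a + 1 ∧ cmk a ∈ A ∧ cmk b ∈ A ∧ ∀ s, a < s → s < b → cmk s ∉ A

lemma exists_next {A : Set (AddCircle (1 : ℝ))} (hA : A.Finite) (hne : A.Nonempty) (t : ℝ) :
    ∃ b, t < b ∧ b ≤ t + 1 ∧ cmk b ∈ A ∧ ∀ s, t < s → s < b → cmk s ∉ A := by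
  obtain ⟨x, hx, hmin⟩ := Set.exists_min_image A
    (fun x => (AddCircle.equivIoc 1 t x : ℝ)) hA hne
  refine ⟨AddCircle.equivIoc 1 t x, (AddCircle.equivIoc 1 t x).2.1,
    (AddCircle.equivIoc 1 t x).2.2, ?_, ?_⟩
  · have : cmk (AddCircle.equivIoc 1 t x) = x := AddCircle.coe_equivIoc (p := 1)
    rwa [this]
  · intro s hs1 hs2 hs3
    have h1 := hmin _ hs3
    have h2 : (AddCircle.equivIoc 1 t (cmk s) : ℝ) = s := by
      have := (AddCircle.equivIoc 1 t x).2.2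
      rw [AddCircle.equivIoc_coe_of_mem (p := 1) ⟨hs1, by linarith⟩]
    simp only [h2] at h1
    linarith

lemma exists_prev {A : Set (AddCircle (1 : ℝ))} (hA : A.Finite) (hne : A.Nonempty) (t : ℝ) :
    ∃ b, b < t ∧ t ≤ b + 1 ∧ cmk b ∈ A ∧ ∀ s, b < s → s < t → cmk s ∉ A := by
  obtain ⟨x, hx, hmax⟩ := Set.exists_max_image A
    (fun x => (AddCircle.equivIco 1 (t-1) x : ℝ)) hA hne
  have h0 := (AddCircle.equivIco 1 (t-1) x).2
  refine ⟨AddCircle.equivIco 1 (t-1) x, by linarith [h0.2], by linarith [h0.1], ?_, ?_⟩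
  · have : cmk (AddCircle.equivIco 1 (t-1) x) = x := AddCircle.coe_equivIco (p := 1)
    rwa [this]
  · intro s hs1 hs2 hs3
    have h1 := hmax _ hs3
    have h2 : (AddCircle.equivIco 1 (t-1) (cmk s) : ℝ) = s := by
      rw [AddCircle.equivIco_coe_of_mem (p := 1) ⟨by linarith [h0.1], by linarith⟩]
    simp only [h2] at h1
    linarith

lemma no_full_gap {A : Set (AddCircle (1 : ℝ))} (h2 : 2 ≤ A.ncard) (a : ℝ)
    (h : ∀ s, a < s → s < a + 1 → cmk s ∉ A) : False := by
  have : A ⊆ {cmk a} := by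
    intro x hx
    obtain ⟨s, h1, h2, rfl⟩ := exists_rep_Ioc a x
    rcases h2.lt_or_eq with h3 | h3
    · exact absurd hx (h s h1 h3)
    · subst h3
      exact cmk_add_one a
  have := Set.ncard_le_ncard this (Set.finite_singleton _)
  rw [Set.ncard_singleton] at this
  omega

lemma exists_gap_from {A : Set (AddCircle (1 : ℝ))} (hA : A.Finite) (h2 : 2 ≤ A.ncard) (a : ℝ)
    (ha : cmk a ∈ A) : ∃ b, IsGap A a b := by
  obtain ⟨b, h3, h4, h5, h6⟩ := exists_next hA ⟨_, ha⟩ a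
  refine ⟨b, h3, ?_, ha, h5, h6⟩
  rcases h4.lt_or_eq with h | h
  · exact h
  · subst h
    exact (no_full_gap h2 a h6).elim

lemma exists_gap_around {A : Set (AddCircle (1 : ℝ))} (hA : A.Finite) (h2 : 2 ≤ A.ncard) (t : ℝ)
    (ht : cmk t ∉ A) : ∃ a b, IsGap A a b ∧ a < t ∧ t < b := by
  have hne : A.Nonempty := Set.nonempty_of_ncard_ne_zero (by omega)
  obtain ⟨b, h3, h4, h5, h6⟩ := exists_next hA hne t
  obtain ⟨a, h3', h4', h5', h6'⟩ := exists_prev hA hne t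
  have h7 : ∀ s, a < s → s < b → cmk s ∉ A := by
    intro s hs1 hs2
    rcases lt_trichotomy s t with h | h | h
    · exact h6' s hs1 h
    · rwa [h]
    · exact h6 s h hs2
  refine ⟨a, b, ⟨by linarith, ?_, h5', h5, h7⟩, h3', h3⟩
  by_contra hcon
  exact no_full_gap h2 a fun s hs1 hs2 => h7 s hs1 (by linarith)

lemma component_eq {A : Set (AddCircle (1 : ℝ))} {a b t : ℝ} (h : IsGap A a b) (h1 : a < t)
    (h2 : t < b) : connectedComponentIn Aᶜ (cmk t) = cmk '' Set.Ioo a b := by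
  obtain ⟨hab, hba, ha, hb, hn⟩ := h
  have hcont : Continuous cmk := AddCircle.continuous_mk' 1
  apply Set.Subset.antisymm
  · have hopen : IsOpen (cmk '' Set.Ioo a b) :=
      QuotientAddGroup.isOpenMap_coe _ isOpen_Ioo
    have hcl : IsClosed (cmk '' Set.Icc a b) := (isCompact_Icc.image hcont).isClosed
    refine isPreconnected_connectedComponentIn.subset_left_of_subset_union hopen hcl.isOpen_compl
      ?_ ?_ ?_
    · exact (disjoint_compl_right).mono_left (Set.image_mono Set.Ioo_subset_Icc_self)
    · intro x hx
      have hxA : x ∉ A := connectedComponentIn_subset _ _ hx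
      by_cases hx2 : x ∈ cmk '' Set.Icc a b
      · left
        obtain ⟨s, ⟨hs1, hs2⟩, rfl⟩ := hx2
        refine ⟨s, ⟨lt_of_le_of_ne hs1 ?_, lt_of_le_of_ne hs2 ?_⟩, rfl⟩
        · rintro rfl
          exact hxA ha
        · rintro rfl
          exact hxA hb
      · right
        exact hx2
    · exact ⟨cmk t, mem_connectedComponentIn (hn t h1 h2), t, ⟨h1, h2⟩, rfl⟩
  · apply (isPreconnected_Ioo.image _ hcont.continuousOn).subset_connectedComponentIn
    · exact ⟨t, ⟨h1, h2⟩, rfl⟩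
    · rintro _ ⟨s, ⟨hs1, hs2⟩, rfl⟩
      exact hn s hs1 hs2

lemma volume_arc {a b : ℝ} (hb : b < a + 1) :
    volume (cmk '' Set.Ioo a b) = ENNReal.ofReal (b - a) := by
  have hopen : IsOpen (cmk '' Set.Ioo a b) :=
      QuotientAddGroup.isOpenMap_coe _ isOpen_Ioo
  have hmp := AddCircle.measurePreserving_mk 1 a
  rw [← hmp.measure_preimage hopen.measurableSet.nullMeasurableSet,
    Measure.restrict_apply (hmp.measurable hopen.measurableSet), ← Real.volume_Ioo]
  congr 1
  ext s
  constructor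
  · rintro ⟨⟨u, ⟨hu1, hu2⟩, hu3⟩, hs1, hs2⟩
    have := (AddCircle.coe_eq_coe_iff_of_mem_Ioc (p := 1) (a := a) ⟨hu1, by linarith⟩
      ⟨hs1, hs2⟩).1 hu3
    subst this
    exact ⟨hu1, hu2⟩
  · rintro ⟨h1, h2⟩
    exact ⟨⟨s, ⟨h1, h2⟩, rfl⟩, h1, by linarith⟩

/-! ### Linked chords intersect -/

lemma area_pos {a b c : ℝ} (h1 : a < b) (h2 : b < c) (h3 : c < a + 1) :
    0 < (Real.cos (2 * Real.pi * b) - Real.cos (2 * Real.pi * a)) *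
        (Real.sin (2 * Real.pi * c) - Real.sin (2 * Real.pi * a)) -
        (Real.sin (2 * Real.pi * b) - Real.sin (2 * Real.pi * a)) *
        (Real.cos (2 * Real.pi * c) - Real.cos (2 * Real.pi * a)) := by
  have key : (Real.cos (2 * Real.pi * b) - Real.cos (2 * Real.pi * a)) *
        (Real.sin (2 * Real.pi * c) - Real.sin (2 * Real.pi * a)) -
        (Real.sin (2 * Real.pi * b) - Real.sin (2 * Real.pi * a)) *
        (Real.cos (2 * Real.pi * c) - Real.cos (2 * Real.pi * a)) =
      4 * (Real.sin (Real.pi * (b - a)) * Real.sin (Real.pi * (c - b)) *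
        Real.sin (Real.pi * (c - a))) := by
    rw [Real.cos_sub_cos, Real.sin_sub_sin, Real.sin_sub_sin, Real.cos_sub_cos]
    have e1 : (2 * Real.pi * b - 2 * Real.pi * a) / 2 = Real.pi * (b - a) := by ring
    have e2 : (2 * Real.pi * c - 2 * Real.pi * a) / 2 = Real.pi * (c - a) := by ring
    have e3 : Real.pi * (c - b) = (2 * Real.pi * c + 2 * Real.pi * a) / 2 -
      (2 * Real.pi * b + 2 * Real.pi * a) / 2 := by ring
    rw [e1, e2, e3, Real.sin_sub]
    ring
  rw [key]
  have hpi := Real.pi_pos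
  have aux : ∀ x : ℝ, 0 < x → x < 1 → 0 < Real.sin (Real.pi * x) := fun x hx hx1 =>
    Real.sin_pos_of_pos_of_lt_pi (by positivity) (by nlinarith)
  have p1 := aux (b - a) (by linarith) (by linarith)
  have p2 := aux (c - b) (by linarith) (by linarith)
  have p3 := aux (c - a) (by linarith) (by linarith)
  positivity

lemma circleEmbed_cmk (x : ℝ) : circleEmbed (cmk x) =
    ⟨Real.cos (2 * Real.pi * x), Real.sin (2 * Real.pi * x)⟩ := by
  unfold circleEmbed
  rw [AddCircle.toCircle_apply_mk, Circle.coe_exp, div_one]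
  apply Complex.ext
  · exact Complex.exp_ofReal_mul_I_re _
  · exact Complex.exp_ofReal_mul_I_im _

lemma linked_not_disjoint {A B : Set (AddCircle (1 : ℝ))} {a b c d : ℝ}
    (hab : a < b) (hbc : b < c) (hcd : c < d) (hda : d < a + 1)
    (ha : cmk a ∈ A) (hc : cmk c ∈ A) (hb : cmk b ∈ B) (hd : cmk d ∈ B)
    (hdis : Disjoint (convexHull ℝ (circleEmbed '' A)) (convexHull ℝ (circleEmbed '' B))) :
    False := by
  have w1 := area_pos hab hbc (by linarith)
  have w2 := area_pos hab (hbc.trans hcd) hda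
  have w3 := area_pos (hab.trans hbc) hcd hda
  have w4 := area_pos hbc hcd (by linarith)
  have ma := subset_convexHull ℝ _ (Set.mem_image_of_mem circleEmbed ha)
  have mb := subset_convexHull ℝ _ (Set.mem_image_of_mem circleEmbed hb)
  have mc := subset_convexHull ℝ _ (Set.mem_image_of_mem circleEmbed hc)
  have md := subset_convexHull ℝ _ (Set.mem_image_of_mem circleEmbed hd)
  rw [circleEmbed_cmk] at ma mb mc md
  generalize Real.cos (2 * Real.pi * a) = xa at *
  generalize Real.cos (2 * Real.pi * b) = xb at *
  generalize Real.cos (2 * Real.pi * c) = xc at *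
  generalize Real.cos (2 * Real.pi * d) = xd at *
  generalize Real.sin (2 * Real.pi * a) = ya at *
  generalize Real.sin (2 * Real.pi * b) = yb at *
  generalize Real.sin (2 * Real.pi * c) = yc at *
  generalize Real.sin (2 * Real.pi * d) = yd at *
  set W1 := (xb - xa) * (yc - ya) - (yb - ya) * (xc - xa) with hW1
  set W2 := (xb - xa) * (yd - ya) - (yb - ya) * (xd - xa) with hW2
  set W3 := (xc - xa) * (yd - ya) - (yc - ya) * (xd - xa) with hW3
  set W4 := (xc - xb) * (yd - yb) - (yc - yb) * (xd - xb) with hW4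
  have hs : W4 + W2 = W3 + W1 := by rw [hW1, hW2, hW3, hW4]; ring
  have hx : W4 * xa + W2 * xc = W3 * xb + W1 * xd := by rw [hW1, hW2, hW3, hW4]; ring
  have hy : W4 * ya + W2 * yc = W3 * yb + W1 * yd := by rw [hW1, hW2, hW3, hW4]; ring
  have hS : 0 < W4 + W2 := by linarith
  have P1 := (convex_convexHull ℝ (circleEmbed '' A)) ma mc
    (div_nonneg w4.le hS.le) (div_nonneg w2.le hS.le) (by field_simp)
  have P2 := (convex_convexHull ℝ (circleEmbed '' B)) mb md
    (div_nonneg w3.le hS.le) (div_nonneg w1.le hS.le) (by rw [hs]; field_simp)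
  refine Set.disjoint_left.1 hdis P1 ?_
  convert P2 using 1
  apply Complex.ext
  · simp only [Complex.add_re, Complex.smul_re, smul_eq_mul]
    field_simp
    linarith
  · simp only [Complex.add_im, Complex.smul_im, smul_eq_mul]
    field_simp
    linarith

lemma gap_pullback {p r : ℕ} (O : FormalOrbitPortrait p r) {j : ZMod p} {a b : ℝ}
    (h : IsGap (O.A (j + 1)) a b) : ∃ a' b', IsGap (O.A j) a' b' ∧ cmk (2 * a') = cmk a ∧
      cmk (2 * b') = cmk b ∧ (2 * (b' - a') = b - a ∨ 2 * (b' - a') = b - a + 1) := by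
  obtain ⟨hab, hba, ha, hb, hn⟩ := h
  obtain ⟨x, hx, hxa⟩ := (O.bijOn j).surjOn ha
  obtain ⟨y, hy, hyb⟩ := (O.bijOn j).surjOn hb
  obtain ⟨a', -, -, rfl⟩ := exists_rep_Ioc 0 x
  obtain ⟨b', h1, h2, rfl⟩ := exists_rep_Ioc a' y
  rw [dbl_cmk] at hxa hyb
  have h3 : b' < a' + 1 := by
    refine lt_of_le_of_ne h2 ?_
    rintro rfl
    have : cmk a = cmk b := by
      rw [← hxa, ← hyb]
      exact ((cmk_eq_iff _ _).2 ⟨2, by push_cast; ring⟩).symm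
    obtain ⟨n, hn⟩ := (cmk_eq_iff _ _).1 this
    have l1 : (n : ℝ) < 0 := by linarith
    have l2 : (-1 : ℝ) < n := by linarith
    have l1' : n < 0 := by exact_mod_cast l1
    have l2' : -1 < n := by exact_mod_cast l2
    omega
  refine ⟨a', b', ⟨h1, h3, hx, hy, ?_⟩, hxa, hyb, ?_⟩
  · intro s hs1 hs2 hs
    have := O.cyclicOrder j _ hx _ hs _ hy ((sbtw_cmk_iff h1 h3 _).2 ⟨s, hs1, hs2, rfl⟩)
    rw [dbl_cmk a', dbl_cmk b', hxa, hyb] at this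
    obtain ⟨u, hu1, hu2, hu3⟩ := (sbtw_cmk_iff hab hba _).1 this
    apply hn u hu1 hu2
    rw [hu3]
    exact (O.bijOn j).mapsTo hs
  · obtain ⟨m, hm⟩ := (cmk_eq_iff _ _).1 hxa
    obtain ⟨n, hn⟩ := (cmk_eq_iff _ _).1 hyb
    have e : 2 * (b' - a') = b - a + ((n - m : ℤ) : ℝ) := by push_cast; linarith
    have l1 : ((n - m : ℤ) : ℝ) < 2 := by linarith
    have l2 : (-1 : ℝ) < ((n - m : ℤ) : ℝ) := by linarith
    have l1' : n - m < 2 := by exact_mod_cast l1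
    have l2' : -1 < n - m := by exact_mod_cast l2
    obtain h | h : n - m = 0 ∨ n - m = 1 := by omega
    · left
      rw [e, h]; simp
    · right
      rw [e, h]; simp

lemma IsGap.shift {A : Set (AddCircle (1 : ℝ))} {a b : ℝ} (h : IsGap A a b) (n : ℤ) :
    IsGap A (a + n) (b + n) := by
  obtain ⟨h1, h2, h3, h4, h5⟩ := h
  refine ⟨by linarith, by linarith, by rwa [cmk_add_int], by rwa [cmk_add_int], ?_⟩
  intro s hs1 hs2
  have := h5 (s - n) (by linarith) (by linarith)
  rwa [← cmk_add_int (s - n) n, sub_add_cancel] at this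

/-- Two gaps of the same minimal length coincide. -/
lemma min_gap_unique {p r : ℕ} (O : FormalOrbitPortrait p r) {l : ℝ} (hl2 : 2 * l ≤ 1)
    (hmin : ∀ j a b, IsGap (O.A j) a b → l ≤ b - a)
    {j k : ZMod p} {a b c d : ℝ} (h1 : IsGap (O.A (j + 1)) a b) (h2 : IsGap (O.A (k + 1)) c d)
    (hl1 : b - a = l) (hl : d - c = l) : cmk a = cmk c := by
  have hl0 : 0 < l := by linarith [h1.1]
  obtain ⟨a', b', g1, ea, eb, hlen⟩ := gap_pullback O h1
  obtain ⟨c', d', g2, ec, ed, hlen'⟩ := gap_pullback O h2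
  have L1 : 2 * (b' - a') = l + 1 := by
    have := hmin _ _ _ g1
    rcases hlen with h | h <;> linarith
  have L2 : 2 * (d' - c') = l + 1 := by
    have := hmin _ _ _ g2
    rcases hlen' with h | h <;> linarith
  obtain ⟨c'', hc1, hc2, hc3⟩ := exists_rep_Ico a' (cmk c')
  obtain ⟨n, rfl⟩ := (cmk_eq_iff _ _).1 hc3
  replace g2 := g2.shift n
  replace ec : cmk (2 * (c' + n)) = cmk c := by
    rw [← ec]
    exact (cmk_eq_iff _ _).2 ⟨2 * n, by push_cast; ring⟩
  replace ed : cmk (2 * (d' + n)) = cmk d := by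
    rw [← ed]
    exact (cmk_eq_iff _ _).2 ⟨2 * n, by push_cast; ring⟩
  replace L2 : 2 * ((d' + n) - (c' + n)) = l + 1 := by linarith
  clear hc3
  generalize c' + (n : ℝ) = C at *
  generalize d' + (n : ℝ) = D at *
  obtain ⟨p1, p2, p3, p4, p5⟩ := g1
  obtain ⟨q1, q2, q3, q4, q5⟩ := g2
  by_cases hjk : j = k
  · subst hjk
    have : C = a' := by
      by_contra hne
      have hlt : a' < C := lt_of_le_of_ne hc1 (Ne.symm hne)
      have hCb : b' ≤ C := by
        by_contra hcon
        exact p5 C hlt (by linarith) q3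
      apply q5 (a' + 1) (by linarith) (by linarith)
      rwa [cmk_add_one]
    rw [← ea, ← ec, this]
  · exfalso
    have hdisj := O.hullDisjoint j k hjk
    have hjk1 : j + 1 ≠ k + 1 := fun h => hjk (add_right_cancel h)
    have hdisj1 := O.hullDisjoint _ _ hjk1
    have share : ∀ {i i' : ZMod p}, i ≠ i' → ∀ {x : ℝ}, cmk x ∈ O.A i → cmk x ∈ O.A i' → False := by
      intro i i' hi x hx hx'
      exact Set.disjoint_left.1 (O.hullDisjoint i i' hi)
        (subset_convexHull ℝ _ (Set.mem_image_of_mem circleEmbed hx))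
        (subset_convexHull ℝ _ (Set.mem_image_of_mem circleEmbed hx'))
    have p3' : cmk (a' + 1) ∈ O.A j := by rwa [cmk_add_one]
    have s1 : a' < C := by
      refine lt_of_le_of_ne hc1 ?_
      rintro rfl
      exact share hjk p3 q3
    have s2 : C < b' := by
      by_contra hcon
      rcases (not_lt.1 hcon).lt_or_eq with h | h
      · exact linked_not_disjoint h hc2 (by linarith) (by linarith : D < b' + 1) p4 p3' q3 q4 hdisj
      · subst h
        exact share hjk p4 q3
    have s3 : a' + 1 < D := by
      by_contra hcon
      rcases (not_lt.1 hcon).lt_or_eq with h | h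
      · exact linked_not_disjoint s1 s2 (by linarith) h p3 p4 q3 q4 hdisj
      · subst h
        exact share hjk p3' q4
    have fa : cmk (2 * a') ∈ O.A (j + 1) := by rw [ea]; exact h1.2.2.1
    have fb : cmk (2 * b' - 1) ∈ O.A (j + 1) := by rw [cmk_sub_one, eb]; exact h1.2.2.2.1
    have fc : cmk (2 * C - 1) ∈ O.A (k + 1) := by rw [cmk_sub_one, ec]; exact h2.2.2.1
    have fd : cmk (2 * D - 1 - 1) ∈ O.A (k + 1) := by
      rw [cmk_sub_one, cmk_sub_one, ed]; exact h2.2.2.2.1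
    rcases lt_trichotomy (2 * C - 1) (2 * a') with h | h | h
    · exact linked_not_disjoint h (by linarith) (by linarith) (by linarith) fc fd fa fb hdisj1.symm
    · rw [h] at fc
      exact share hjk1 fa fc
    · exact linked_not_disjoint h (by linarith) (by linarith) (by linarith) fa fb fc fd hdisj1

/-- For a formal orbit portrait of valence `v ≥ 2`, among all complementary arcs of all the
sets `A_1, …, A_p` there is a unique shortest one: its length is strictly smaller than that
of every other complementary arc. -/
theorem formalOrbitPortrait_unique_shortest_arc (p r v : ℕ) (O : FormalOrbitPortrait p r)
    (hv : ∀ j, (O.A j).ncard = v) (hv2 : 2 ≤ v) :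
    ∃ i : ZMod p, ∃ I : Set (AddCircle (1 : ℝ)), IsComplArc (O.A i) I ∧
      ∀ j : ZMod p, ∀ J : Set (AddCircle (1 : ℝ)), IsComplArc (O.A j) J → J ≠ I →
        volume I < volume J := by
  have hcard : ∀ j, 2 ≤ (O.A j).ncard := fun j => by rw [hv j]; exact hv2
  have : NeZero p := ⟨O.hp.ne'⟩
  -- the finite set of lengths
  let Ls : Set ℝ := {l | ∃ j a b, IsGap (O.A j) a b ∧ b - a = l}
  have hfin : Ls.Finite := by
    have hU : (⋃ j, O.A j).Finite := Set.finite_iUnion O.finite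
    refine ((hU.prod hU).image
      (fun q => (AddCircle.equivIco 1 0 (q.2 - q.1) : ℝ))).subset ?_
    rintro l ⟨j, a, b, ⟨h1, h2, h3, h4, -⟩, rfl⟩
    refine ⟨(cmk a, cmk b), ⟨Set.mem_iUnion.2 ⟨j, h3⟩, Set.mem_iUnion.2 ⟨j, h4⟩⟩, ?_⟩
    have : cmk b - cmk a = cmk (b - a) := (AddCircle.coe_sub _ _ _).symm
    simp only [this]
    rw [AddCircle.equivIco_coe_of_mem (p := 1) ⟨by linarith, by linarith⟩]
  have hne : Ls.Nonempty := by
    obtain ⟨x, hx⟩ := O.nonempty 0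
    obtain ⟨a, -, -, rfl⟩ := exists_rep_Ioc 0 x
    obtain ⟨b, hb⟩ := exists_gap_from (O.finite 0) (hcard 0) a hx
    exact ⟨_, 0, a, b, hb, rfl⟩
  obtain ⟨l, ⟨i, a, b, hg, hl⟩, hlmin⟩ := Set.exists_min_image Ls id hfin hne
  have hmin : ∀ j a b, IsGap (O.A j) a b → l ≤ b - a := fun j a b h =>
    hlmin _ ⟨j, a, b, h, rfl⟩
  have hl2 : 2 * l ≤ 1 := by
    obtain ⟨c, hc⟩ := exists_gap_from (O.finite i) (hcard i) b hg.2.2.2.1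
    have h1 := hmin _ _ _ hc
    have h2 : c ≤ a + 1 := by
      by_contra hcon
      apply hc.2.2.2.2 (a + 1) hg.2.1 (by linarith)
      rw [cmk_add_one]
      exact hg.2.2.1
    linarith
  have hmid1 : a < (a + b) / 2 := by linarith [hg.1]
  have hmid2 : (a + b) / 2 < b := by linarith [hg.1]
  refine ⟨i, cmk '' Set.Ioo a b, ⟨cmk ((a + b) / 2), hg.2.2.2.2 _ hmid1 hmid2,
    (component_eq hg hmid1 hmid2).symm⟩, ?_⟩
  rintro j J ⟨x, hx, rfl⟩ hJ
  obtain ⟨t, -, -, rfl⟩ := exists_rep_Ioc 0 x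
  obtain ⟨c, d, hg', h1, h2⟩ := exists_gap_around (O.finite j) (hcard j) t hx
  rw [component_eq hg' h1 h2] at hJ ⊢
  rw [volume_arc hg.2.1, volume_arc hg'.2.1, ENNReal.ofReal_lt_ofReal_iff (by linarith [hg'.1]), hl]
  refine lt_of_le_of_ne (hmin _ _ _ hg') fun heq => hJ ?_
  have e := min_gap_unique O hl2 hmin (j := i - 1) (k := j - 1) (by rwa [sub_add_cancel])
    (by rwa [sub_add_cancel]) hl heq.symm
  obtain ⟨n, hn⟩ := (cmk_eq_iff _ _).1 e
  have hbd : b = d + n := by linarith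
  ext y
  constructor
  · rintro ⟨s, ⟨hs1, hs2⟩, rfl⟩
    exact ⟨s + n, ⟨by linarith, by linarith⟩, cmk_add_int s n⟩
  · rintro ⟨s, ⟨hs1, hs2⟩, rfl⟩
    refine ⟨s - n, ⟨by linarith, by linarith⟩, ?_⟩
    rw [← cmk_add_int (s - n) n, sub_add_cancel]
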